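/- arXiv:1612.09397 — 2 statements merged into one kernel-verified Lean document; each statement's English description precedes it below -/
import Mathlib

section
/- Suppose m ≥ 5. For every pair of distinct elements u, v ∈ X with u + v ≠ 1, the number of blocks B ∈ W_5 with u ∈ B and v ∈ B equals λ_5 = (2^m − 8)(2^m − 16)/3!; that is, the triple (X, W_2, W_5) is a group divisible design GDD(2^m − 2, 2, 5) with balance parameter λ_5 = (2^m − 8)(2^m − 16)/6. -/
open scoped Classical

noncomputable section

/-- `X = GF(2^m) \\ {0, 1}`. -/
def designX (m : ℕ) : Set (GaloisField 2 m) := {x | x ≠ 0 ∧ x ≠ 1}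

/-- `W_k`: the collection of all `k`-element subsets `B` of `X` whose element-sum is `1`
and such that no nonempty proper subset of `B` has element-sum `1`. -/
def designW (m k : ℕ) : Set (Finset (GaloisField 2 m)) :=
  {B | (B : Set (GaloisField 2 m)) ⊆ designX m ∧ B.card = k ∧ B.sum id = 1 ∧
    ∀ I ⊆ B, I.Nonempty → I ≠ B → I.sum id ≠ 1}

set_option linter.all false

section helpers
variable {F : Type*} [Field F] [CharP F 2]

def spanS (u v : F) : Finset F := {0, 1, u, v, 1 + u, 1 + v, u + v, 1 + u + v}

lemma spanS_card (u v : F) (hu0 : u ≠ 0) (hu1 : u ≠ 1) (hv0 : v ≠ 0) (hv1 : v ≠ 1)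
    (huv : u ≠ v) (hs : u + v ≠ 1) : (spanS u v).card = 8 := by
  have h10 : (1 : F) ≠ 0 := one_ne_zero
  have h2 : (2 : F) = 0 := CharTwo.two_eq_zero
  unfold spanS
  repeat rw [Finset.card_insert_of_notMem]
  · simp
  all_goals
    simp only [Finset.mem_insert, Finset.mem_singleton, not_or]
    grind

lemma spanS_add (u v x y : F) (hx : x ∈ spanS u v) (hy : y ∈ spanS u v) : x + y ∈ spanS u v := by
  have h2 : (2 : F) = 0 := CharTwo.two_eq_zero
  simp only [spanS, Finset.mem_insert, Finset.mem_singleton] at *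
  rcases hx with rfl | rfl | rfl | rfl | rfl | rfl | rfl | rfl <;>
  rcases hy with rfl | rfl | rfl | rfl | rfl | rfl | rfl | rfl <;> grind

lemma spanT_card (u v a : F) (h8 : (spanS u v).card = 8) (ha : a ∉ spanS u v) :
    (spanS u v ∪ (spanS u v).image (· + a)).card = 16 := by
  rw [Finset.card_union_of_disjoint, Finset.card_image_of_injective _ (add_left_injective a), h8]
  rw [Finset.disjoint_left]
  intro x hx hx'
  obtain ⟨y, hy, rfl⟩ := Finset.mem_image.1 hx'
  apply ha
  have := spanS_add u v _ _ hy hx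
  rwa [← add_assoc, CharTwo.add_self_eq_zero, zero_add] at this

/-- block predicate -/
def isBlk (u v : F) (B : Finset F) : Prop :=
  ((∀ x ∈ B, x ≠ 0 ∧ x ≠ 1) ∧ B.card = 5 ∧ B.sum id = 1 ∧
    ∀ I ⊆ B, I.Nonempty → I ≠ B → I.sum id ≠ 1) ∧ u ∈ B ∧ v ∈ B

def goodP (u v : F) (p : F × F) : Prop :=
  p.1 ∉ spanS u v ∧ p.2 ∉ spanS u v ∪ (spanS u v).image (· + p.1)

def mkB (u v : F) (p : F × F) : Finset F := {u, v, p.1, p.2, 1 + u + v + p.1 + p.2}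

lemma good_iff (u v a b : F) : goodP u v (a, b) ↔
    (a ∉ spanS u v ∧ b ∉ spanS u v ∧ a + b ∉ spanS u v) := by
  have h2 : (2 : F) = 0 := CharTwo.two_eq_zero
  simp only [goodP, Finset.mem_union, Finset.mem_image, not_or]
  constructor
  · rintro ⟨h, h', h''⟩
    refine ⟨h, h', fun h3 => h'' ⟨_, h3, ?_⟩⟩
    grind
  · rintro ⟨h, h', h''⟩
    refine ⟨h, h', ?_⟩
    rintro ⟨y, hy, rfl⟩
    apply h''
    convert hy using 1
    grind

lemma mkB_blk (u v a b : F) (hu0 : u ≠ 0) (hu1 : u ≠ 1) (hv0 : v ≠ 0) (hv1 : v ≠ 1)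
    (huv : u ≠ v) (hs : u + v ≠ 1) (h : goodP u v (a, b)) : isBlk u v (mkB u v (a, b)) := by
  have h10 : (1 : F) ≠ 0 := one_ne_zero
  have h2 : (2 : F) = 0 := CharTwo.two_eq_zero
  rw [good_iff] at h
  simp only [spanS, Finset.mem_insert, Finset.mem_singleton, not_or] at h
  obtain ⟨⟨a1, a2, a3, a4, a5, a6, a7, a8⟩, ⟨b1, b2, b3, b4, b5, b6, b7, b8⟩,
    ⟨c1, c2, c3, c4, c5, c6, c7, c8⟩⟩ := h
  have n1 : u ∉ ({v, a, b, 1 + u + v + a + b} : Finset F) := by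
    simp only [Finset.mem_insert, Finset.mem_singleton, not_or]
    refine ⟨?_, ?_, ?_, ?_⟩ <;> grind
  have n2 : v ∉ ({a, b, 1 + u + v + a + b} : Finset F) := by
    simp only [Finset.mem_insert, Finset.mem_singleton, not_or]
    refine ⟨?_, ?_, ?_⟩ <;> grind
  have n3 : a ∉ ({b, 1 + u + v + a + b} : Finset F) := by
    simp only [Finset.mem_insert, Finset.mem_singleton, not_or]
    refine ⟨?_, ?_⟩ <;> grind
  have n4 : b ∉ ({1 + u + v + a + b} : Finset F) := by
    simp only [Finset.mem_singleton]
    grind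
  have e : mkB u v (a, b) = {u, v, a, b, 1 + u + v + a + b} := rfl
  rw [e]
  refine ⟨⟨?_, ?_, ?_, ?_⟩, by simp, by simp⟩
  · intro x hx
    simp only [Finset.mem_insert, Finset.mem_singleton] at hx
    rcases hx with rfl | rfl | rfl | rfl | rfl <;> constructor <;> grind
  · rw [Finset.card_insert_of_notMem n1, Finset.card_insert_of_notMem n2,
      Finset.card_insert_of_notMem n3, Finset.card_insert_of_notMem n4, Finset.card_singleton]
  · rw [Finset.sum_insert n1, Finset.sum_insert n2, Finset.sum_insert n3, Finset.sum_insert n4,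
      Finset.sum_singleton]
    simp only [id]
    grind
  · intro I hI hne hneq hsum
    have hs' : I.sum id = ∑ x ∈ ({u, v, a, b, 1 + u + v + a + b} : Finset F),
        if x ∈ I then x else 0 := by
      rw [← Finset.sum_filter, Finset.filter_mem_eq_inter, Finset.inter_eq_right.2 hI]
      rfl
    rw [hs', Finset.sum_insert n1, Finset.sum_insert n2, Finset.sum_insert n3,
      Finset.sum_insert n4, Finset.sum_singleton] at hsum
    have hall : ¬ (u ∈ I ∧ v ∈ I ∧ a ∈ I ∧ b ∈ I ∧ 1 + u + v + a + b ∈ I) := by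
      rintro ⟨q1, q2, q3, q4, q5⟩
      apply hneq
      apply Finset.Subset.antisymm hI
      intro x hx
      simp only [Finset.mem_insert, Finset.mem_singleton] at hx
      rcases hx with rfl | rfl | rfl | rfl | rfl <;> assumption
    clear hs' hI hneq n1 n2 n3 n4 e hne
    by_cases q1 : u ∈ I <;> by_cases q2 : v ∈ I <;> by_cases q3 : a ∈ I <;>
      by_cases q4 : b ∈ I <;> by_cases q5 : 1 + u + v + a + b ∈ I <;>
      simp only [q1, q2, q3, q4, q5, if_true, if_false, and_self, not_true_eq_false] at hsum hall <;>
      clear q1 q2 q3 q4 q5 hall <;> grind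

set_option maxHeartbeats 4000000 in
lemma fiber (u v : F) (huv : u ≠ v) (B : Finset F) (hB : isBlk u v B) (p : F × F) :
    (goodP u v p ∧ mkB u v p = B) ↔ p ∈ (B \ {u, v}).offDiag := by
  have h2 : (2 : F) = 0 := CharTwo.two_eq_zero
  obtain ⟨a, b⟩ := p
  obtain ⟨⟨hX, hc, hsum, hI⟩, huB, hvB⟩ := hB
  rw [Finset.mem_offDiag]
  constructor
  · rintro ⟨h, rfl⟩
    rw [good_iff] at h
    simp only [spanS, Finset.mem_insert, Finset.mem_singleton, not_or] at h
    obtain ⟨⟨a1, a2, a3, a4, a5, a6, a7, a8⟩, ⟨b1, b2, b3, b4, b5, b6, b7, b8⟩,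
      ⟨c1, c2, c3, c4, c5, c6, c7, c8⟩⟩ := h
    refine ⟨?_, ?_, ?_⟩
    · simp [mkB, a3, a4]
    · simp [mkB, b3, b4]
    · intro (hE : a = b)
      subst hE
      exact c1 (CharTwo.add_self_eq_zero _)
  · rintro ⟨ha, hb, hab⟩
    simp only at ha hb hab
    simp only [Finset.mem_sdiff, Finset.mem_insert, Finset.mem_singleton, not_or] at ha hb
    obtain ⟨haB, hau, hav⟩ := ha
    obtain ⟨hbB, hbu, hbv⟩ := hb
    have hD : ({u, v, a, b} : Finset F) ⊆ B := by
      intro x hx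
      simp only [Finset.mem_insert, Finset.mem_singleton] at hx
      rcases hx with rfl | rfl | rfl | rfl <;> assumption
    have n1 : u ∉ ({v, a, b} : Finset F) := by
      simp only [Finset.mem_insert, Finset.mem_singleton, not_or]
      exact ⟨huv, Ne.symm hau, Ne.symm hbu⟩
    have n2 : v ∉ ({a, b} : Finset F) := by
      simp only [Finset.mem_insert, Finset.mem_singleton, not_or]
      exact ⟨Ne.symm hav, Ne.symm hbv⟩
    have n3 : a ∉ ({b} : Finset F) := by simpa using hab
    have hD4 : ({u, v, a, b} : Finset F).card = 4 := by
      rw [Finset.card_insert_of_notMem n1, Finset.card_insert_of_notMem n2,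
        Finset.card_insert_of_notMem n3, Finset.card_singleton]
    have hsd := Finset.card_sdiff_of_subset hD
    rw [hc, hD4] at hsd
    obtain ⟨c, hcc⟩ := Finset.card_eq_one.1 hsd
    have hs1 := Finset.sum_sdiff (f := id) hD
    rw [hcc, Finset.sum_singleton, Finset.sum_insert n1, Finset.sum_insert n2,
      Finset.sum_insert n3, Finset.sum_singleton, hsum] at hs1
    simp only [id] at hs1
    have hce : c = 1 + u + v + a + b := by grind
    have hcm : c ∈ B \ ({u, v, a, b} : Finset F) := by rw [hcc]; simp
    have hBe : mkB u v (a, b) = B := by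
      apply Finset.eq_of_subset_of_card_le
      · intro x hx
        simp only [mkB, Finset.mem_insert, Finset.mem_singleton, ← hce] at hx
        have := (Finset.mem_sdiff.1 hcm).1
        rcases hx with rfl | rfl | rfl | rfl | rfl <;> assumption
      · have : mkB u v (a, b) = insert c {u, v, a, b} := by
          ext x; simp only [mkB, ← hce, Finset.mem_insert, Finset.mem_singleton]; tauto
        rw [this, Finset.card_insert_of_notMem (Finset.mem_sdiff.1 hcm).2, hD4, hc]
    refine ⟨?_, hBe⟩
    -- subsets of D summing to 1 or 0 are impossible
    have key1 : ∀ I ⊆ ({u, v, a, b} : Finset F), I.sum id ≠ 1 := by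
      intro I hID hs
      rcases I.eq_empty_or_nonempty with rfl | hne
      · simp at hs
      · refine hI I (hID.trans hD) hne ?_ hs
        rintro rfl
        have := Finset.card_le_card hID
        omega
    have key0 : ∀ I ⊆ ({u, v, a, b} : Finset F), I.Nonempty → I.sum id ≠ 0 := by
      intro I hID hne hs
      have hIB := hID.trans hD
      refine hI (B \ I) Finset.sdiff_subset ⟨c, ?_⟩ ?_ ?_
      · rw [Finset.mem_sdiff] at hcm ⊢
        exact ⟨hcm.1, fun h => hcm.2 (hID h)⟩
      · intro h
        obtain ⟨x, hx⟩ := hne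
        have := hIB hx
        rw [← h] at this
        exact (Finset.mem_sdiff.1 this).2 hx
      · have := Finset.sum_sdiff (f := id) hIB
        rw [hs, hsum, add_zero] at this
        exact this
    have key : ∀ I ⊆ ({u, v, a, b} : Finset F), I.Nonempty → I.sum id ≠ 0 ∧ I.sum id ≠ 1 :=
      fun I h h' => ⟨key0 I h h', key1 I h⟩
    have hs2 : ∀ x y : F, x ≠ y → ({x, y} : Finset F).sum id = x + y := by
      intro x y h; rw [Finset.sum_pair h]; rfl
    have ka := key {a} (by intro x; simp; tauto) (by simp)
    have kb := key {b} (by intro x; simp; tauto) (by simp)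
    have kua := key {u, a} (by intro x; simp; tauto) (by simp)
    have kva := key {v, a} (by intro x; simp; tauto) (by simp)
    have kub := key {u, b} (by intro x; simp; tauto) (by simp)
    have kvb := key {v, b} (by intro x; simp; tauto) (by simp)
    have kab := key {a, b} (by intro x; simp; tauto) (by simp)
    have kuva := key {u, v, a} (by intro x; simp; tauto) (by simp)
    have kuvb := key {u, v, b} (by intro x; simp; tauto) (by simp)
    have kuab := key {u, a, b} (by intro x; simp; tauto) (by simp)
    have kvab := key {v, a, b} (by intro x; simp; tauto) (by simp)
    have kuvab := key {u, v, a, b} (by intro x; simp) (by simp)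
    rw [Finset.sum_insert n1, Finset.sum_insert n2, hs2 _ _ hab] at kuvab
    rw [Finset.sum_insert n2, hs2 _ _ hab] at kvab
    rw [Finset.sum_insert (by simp; exact ⟨Ne.symm hau, Ne.symm hbu⟩), hs2 _ _ hab] at kuab
    rw [Finset.sum_insert (by simp; exact ⟨huv, Ne.symm hau⟩), hs2 _ _ (Ne.symm hav)] at kuva
    rw [Finset.sum_insert (by simp; exact ⟨huv, Ne.symm hbu⟩), hs2 _ _ (Ne.symm hbv)] at kuvb
    rw [hs2 _ _ hab] at kab
    rw [hs2 _ _ (Ne.symm hau)] at kua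
    rw [hs2 _ _ (Ne.symm hav)] at kva
    rw [hs2 _ _ (Ne.symm hbu)] at kub
    rw [hs2 _ _ (Ne.symm hbv)] at kvb
    rw [Finset.sum_singleton] at ka kb
    simp only [id] at ka kb kua kva kub kvb kab kuva kuvb kuab kvab kuvab
    rw [good_iff]
    clear key key0 key1 hI hs2 hBe hcm hcc hsd hD4 hD n1 n2 n3 hX hsum
    simp only [spanS, Finset.mem_insert, Finset.mem_singleton, not_or]
    refine ⟨⟨?_, ?_, ?_, ?_, ?_, ?_, ?_, ?_⟩, ⟨?_, ?_, ?_, ?_, ?_, ?_, ?_, ?_⟩,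
      ⟨?_, ?_, ?_, ?_, ?_, ?_, ?_, ?_⟩⟩ <;> grind

lemma main_count [Fintype F] (u v : F) (hu0 : u ≠ 0) (hu1 : u ≠ 1) (hv0 : v ≠ 0) (hv1 : v ≠ 1)
    (huv : u ≠ v) (hs : u + v ≠ 1) :
    (Finset.univ.filter (isBlk u v)).card * 6
      = (Fintype.card F - 8) * (Fintype.card F - 16) := by
  have h8 := spanS_card u v hu0 hu1 hv0 hv1 huv hs
  have hP : (Finset.univ.filter (goodP u v)).card =
      (Fintype.card F - 8) * (Fintype.card F - 16) := by
    have : Finset.univ.filter (goodP u v) = ((spanS u v)ᶜ).biUnion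
        (fun a => ((spanS u v ∪ (spanS u v).image (· + a))ᶜ).image (fun b => (a, b))) := by
      ext ⟨a, b⟩
      simp only [goodP, Finset.mem_filter, Finset.mem_univ, true_and, Finset.mem_biUnion,
        Finset.mem_compl, Finset.mem_image (f := fun b => (_, b)), Prod.mk.injEq]
      constructor
      · rintro ⟨h, h'⟩
        exact ⟨a, h, b, h', rfl, rfl⟩
      · rintro ⟨_, h, _, h', rfl, rfl⟩
        exact ⟨h, h'⟩
    rw [this, Finset.card_biUnion]
    · rw [Finset.sum_congr rfl (g := fun _ => Fintype.card F - 16), Finset.sum_const,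
        Finset.card_compl, h8, smul_eq_mul]
      intro a ha
      rw [Finset.card_image_of_injective _ (Prod.mk_right_injective a), Finset.card_compl,
        spanT_card u v a h8 (Finset.mem_compl.1 ha)]
    · intro x _ y _ hxy
      rw [Function.onFun, Finset.disjoint_left]
      intro p hp hp'
      obtain ⟨_, _, rfl⟩ := Finset.mem_image.1 hp
      obtain ⟨_, _, h⟩ := Finset.mem_image.1 hp'
      exact hxy (Prod.mk.inj h).1.symm
  rw [← hP, Finset.card_eq_sum_card_fiberwise (f := mkB u v)
    (t := Finset.univ.filter (isBlk u v))]
  · rw [Finset.sum_congr rfl (g := fun _ => 6), Finset.sum_const, smul_eq_mul]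
    intro B hB
    have hB := (Finset.mem_filter.1 hB).2
    have : (Finset.univ.filter (goodP u v)).filter (fun p => mkB u v p = B)
        = (B \ {u, v}).offDiag := by
      ext p
      rw [← fiber u v huv B hB p]
      simp
    rw [this, Finset.offDiag_card, Finset.card_sdiff_of_subset, Finset.card_pair huv, hB.1.2.1]
    intro x hx
    simp only [Finset.mem_insert, Finset.mem_singleton] at hx
    rcases hx with rfl | rfl
    exacts [hB.2.1, hB.2.2]
  · rintro ⟨a, b⟩ h
    simp only [Finset.coe_filter, Finset.mem_univ, true_and, Set.mem_setOf_eq] at h ⊢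
    exact mkB_blk u v a b hu0 hu1 hv0 hv1 huv hs h

end helpers

/-- For `m ≥ 5` and distinct `u, v ∈ X` with `u + v ≠ 1`, exactly `λ_5 = (2^m-8)(2^m-16)/3!`
blocks of `W_5` contain both `u` and `v`; that is, `(X, W_2, W_5)` is a
`GDD(2^m - 2, 2, 5)` with balance parameter `λ_5`. -/
theorem GDD_W5 (m : ℕ) (hm : 5 ≤ m) (u v : GaloisField 2 m)
    (hu : u ∈ designX m) (hv : v ∈ designX m) (huv : u ≠ v) (hsum : u + v ≠ 1) :
    {B ∈ designW m 5 | u ∈ B ∧ v ∈ B}.ncard = (2 ^ m - 8) * (2 ^ m - 16) / Nat.factorial 3 := by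
  haveI : Fintype (GaloisField 2 m) := Fintype.ofFinite _
  have hcard : Fintype.card (GaloisField 2 m) = 2 ^ m := by
    rw [← Nat.card_eq_fintype_card, GaloisField.card 2 m (by omega)]
  have h := main_count u v hu.1 hu.2 hv.1 hv.2 huv hsum
  have e : {B ∈ designW m 5 | u ∈ B ∧ v ∈ B} =
      ((Finset.univ.filter (isBlk u v) : Finset (Finset (GaloisField 2 m))) :
        Set (Finset (GaloisField 2 m))) := by
    ext B
    simp only [Finset.coe_filter, Finset.mem_univ, true_and, Set.mem_setOf_eq]
    rfl
  rw [e, Set.ncard_coe_finset, ← hcard, ← h]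
  exact (Nat.mul_div_cancel _ (by norm_num)).symm
end
end

section
/- Suppose m ≥ 7. Then every element x ∈ X is contained in exactly r_7 = (2^m − 4)(2^m − 8)(2^m − 16)(2^m − 32)(2^m − 64)/6! blocks of W_7, and the total number of blocks is |W_7| = (2^m − 2)(2^m − 4)(2^m − 8)(2^m − 16)(2^m − 32)(2^m − 64)/7!. -/
open scoped Classical

noncomputable section

set_option linter.unusedSectionVars false

section Helpers

variable {F : Type*} [Field F] [CharP F 2]

/-- No nonempty subset of `G` sums to zero. -/
def IndSet (G : Finset F) : Prop := ∀ I ⊆ G, I.Nonempty → I.sum id ≠ 0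

/-- `S` together with `1` is independent. -/
def GoodSet (S : Finset F) : Prop := (1 : F) ∉ S ∧ IndSet (insert 1 S)

/-- Blocks in terms of independence. -/
def IsBlock (B : Finset F) : Prop := B.card = 7 ∧ B.sum id = 1 ∧ IndSet B

lemma IndSet.mono {G H : Finset F} (h : IndSet H) (hGH : G ⊆ H) : IndSet G :=
  fun I hI hn => h I (hI.trans hGH) hn

lemma sum_sdiff_char {I J : Finset F} (h : J ⊆ I) : (I \ J).sum id = I.sum id + J.sum id := by
  have := Finset.sum_sdiff (f := (id : F → F)) h
  rw [← this, add_assoc, CharTwo.add_self_eq_zero, add_zero]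

lemma sum_symmDiff_char (I J : Finset F) :
    (symmDiff I J).sum id = I.sum id + J.sum id := by
  have h1 : symmDiff I J = (I ∪ J) \ (I ∩ J) := by
    ext a; simp only [Finset.mem_symmDiff, Finset.mem_sdiff, Finset.mem_union, Finset.mem_inter]
    tauto
  rw [h1, sum_sdiff_char (Finset.inter_subset_union), Finset.sum_union_inter]

lemma GoodSet.sum_ne_one {S : Finset F} (h : GoodSet S) {I : Finset F} (hI : I ⊆ S) :
    I.sum id ≠ 1 := by
  intro hs
  refine h.2 (insert 1 I) (Finset.insert_subset_insert _ hI) (Finset.insert_nonempty _ _) ?_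
  rw [Finset.sum_insert (fun h1 => h.1 (hI h1)), hs]
  simp [CharTwo.add_self_eq_zero]

lemma GoodSet.of {S : Finset F} (h : IndSet S) (h1 : ∀ I ⊆ S, I.sum id ≠ 1) : GoodSet S := by
  refine ⟨fun hm => h1 {1} (by simpa using hm) (by simp), fun I hI hn hs => ?_⟩
  by_cases hm : (1 : F) ∈ I
  · refine h1 (I.erase 1) ?_ ?_
    · intro a ha
      have := hI (Finset.mem_of_mem_erase ha)
      exact (Finset.mem_insert.1 this).resolve_left (Finset.ne_of_mem_erase ha)
    · have := Finset.add_sum_erase I (id : F → F) hm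
      rw [hs] at this
      exact ((CharTwo.add_eq_zero).1 this).symm
  · refine h I ?_ hn hs
    intro a ha
    refine (Finset.mem_insert.1 (hI ha)).resolve_left ?_
    rintro rfl; exact hm ha

lemma IsBlock.sum_ne_one {B : Finset F} (h : IsBlock B) {I : Finset F} (hI : I ⊆ B)
    (hne : I ≠ B) : I.sum id ≠ 1 := by
  intro hs
  refine h.2.2 (B \ I) Finset.sdiff_subset ?_ ?_
  · rw [Finset.sdiff_nonempty]
    exact fun h' => hne (hI.antisymm h')
  · rw [sum_sdiff_char hI, hs, h.2.1, CharTwo.add_self_eq_zero]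

lemma IsBlock.good {B : Finset F} (h : IsBlock B) {S : Finset F} (hS : S ⊆ B)
    (hne : S ≠ B) : GoodSet S := by
  refine GoodSet.of (h.2.2.mono hS) fun I hI => h.sum_ne_one (hI.trans hS) ?_
  rintro rfl
  exact hne (hS.antisymm hI)

/-- All subset sums of `S ∪ {1}`. -/
def spanSet (S : Finset F) : Finset F := (insert 1 S).powerset.image (fun I => I.sum id)

lemma IndSet.card_sums {G : Finset F} (h : IndSet G) :
    (G.powerset.image (fun I => I.sum id)).card = 2 ^ G.card := by
  rw [Finset.card_image_of_injOn, Finset.card_powerset]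
  intro I hI J hJ hIJ
  simp only [Finset.coe_powerset, Set.mem_preimage, Set.mem_powerset_iff, Finset.coe_subset] at hI hJ
  by_contra hne
  refine h (symmDiff I J) ?_ ?_ ?_
  · intro a ha
    rw [Finset.mem_symmDiff] at ha
    rcases ha with ha | ha
    · exact hI ha.1
    · exact hJ ha.1
  · rw [Finset.nonempty_iff_ne_empty]
    intro h0
    exact hne (symmDiff_eq_bot.1 h0)
  · rw [sum_symmDiff_char]
    exact CharTwo.add_eq_zero.2 hIJ

lemma GoodSet.card_span {S : Finset F} (h : GoodSet S) :
    (spanSet S).card = 2 ^ (S.card + 1) := by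
  rw [spanSet, h.2.card_sums, Finset.card_insert_of_notMem h.1]

lemma subset_spanSet {S : Finset F} {y : F} (h : y ∈ insert 1 S) : y ∈ spanSet S :=
  Finset.mem_image.2 ⟨{y}, by simpa using h, by simp⟩

lemma GoodSet.insert_good {S : Finset F} (h : GoodSet S) {y : F} (hy : y ∉ spanSet S) :
    GoodSet (insert y S) := by
  have hy1 : y ∉ insert 1 S := fun h' => hy (subset_spanSet h')
  refine ⟨fun h1 => ?_, fun I hI hn hs => ?_⟩
  · rcases Finset.mem_insert.1 h1 with h1 | h1
    · exact hy1 (by simp [← h1])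
    · exact h.1 h1
  · rw [Finset.insert_comm] at hI
    by_cases hm : y ∈ I
    · apply hy
      refine Finset.mem_image.2 ⟨I.erase y, ?_, ?_⟩
      · rw [Finset.mem_powerset]
        exact Finset.subset_insert_iff.1 hI
      · have := Finset.add_sum_erase I (id : F → F) hm
        rw [hs] at this
        exact ((CharTwo.add_eq_zero).1 this).symm
    · exact h.2 I ((Finset.subset_insert_iff_of_notMem hm).1 hI) hn hs

lemma GoodSet.notMem_span {S : Finset F} {y : F} (hyS : y ∉ S) (h : GoodSet (insert y S)) :
    y ∉ spanSet S := by
  intro hy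
  obtain ⟨I, hI, hs⟩ := Finset.mem_image.1 hy
  rw [Finset.mem_powerset] at hI
  have hy1 : y ≠ 1 := by
    rintro rfl; exact h.1 (Finset.mem_insert_self _ _)
  have hyI : y ∉ I := fun h' => by
    rcases Finset.mem_insert.1 (hI h') with h' | h'
    · exact hy1 h'
    · exact hyS h'
  refine h.2 (insert y I) ?_ (Finset.insert_nonempty _ _) ?_
  · rw [Finset.insert_comm]
    exact Finset.insert_subset_insert _ hI
  · rw [Finset.sum_insert hyI, hs]
    exact CharTwo.add_self_eq_zero y

variable [Fintype F]

/-- Blocks containing `S`. -/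
def blocksOver (S : Finset F) : Finset (Finset F) :=
  Finset.univ.filter (fun B => IsBlock B ∧ S ⊆ B)

lemma mem_blocksOver {S B : Finset F} : B ∈ blocksOver S ↔ IsBlock B ∧ S ⊆ B := by
  simp [blocksOver]

lemma blocks_base {S : Finset F} (h : GoodSet S) (hc : S.card = 6) :
    (blocksOver S).card = 1 := by
  rw [Finset.card_eq_one]
  have key : ∀ J ⊆ S, J.sum id ≠ 1 := fun J hJ => h.sum_ne_one hJ
  set y : F := 1 + S.sum id with hy
  have hyS : y ∉ S := by
    intro hm
    apply key (S.erase y) (Finset.erase_subset _ _)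
    have := Finset.add_sum_erase S (id : F → F) hm
    have h2 : y + S.sum id = 1 := by
      rw [hy, add_assoc, CharTwo.add_self_eq_zero, add_zero]
    rw [← this, id, ← add_assoc, CharTwo.add_self_eq_zero, zero_add] at h2
    exact h2
  have hysum : (insert y S).sum id = 1 := by
    rw [Finset.sum_insert hyS, id, hy, add_assoc, CharTwo.add_self_eq_zero, add_zero]
  refine ⟨insert y S, ?_⟩
  ext B
  rw [mem_blocksOver, Finset.mem_singleton]
  constructor
  · rintro ⟨hB, hSB⟩
    have hcard : (B \ S).card = 1 := by
      rw [Finset.card_sdiff_of_subset hSB, hB.1, hc]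
    obtain ⟨z, hz⟩ := Finset.card_eq_one.1 hcard
    have hs := sum_sdiff_char hSB
    rw [hz, hB.2.1, Finset.sum_singleton, id] at hs
    rw [← Finset.sdiff_union_of_subset hSB, hz, hs]
    rfl
  · rintro rfl
    refine ⟨⟨by rw [Finset.card_insert_of_notMem hyS, hc], hysum, ?_⟩, Finset.subset_insert _ _⟩
    intro I hI hn hs
    by_cases hm : y ∈ I
    · refine key (insert y S \ I) ?_ ?_
      · intro a ha
        rw [Finset.mem_sdiff] at ha
        refine (Finset.mem_insert.1 ha.1).resolve_left ?_
        rintro rfl; exact ha.2 hm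
      · rw [sum_sdiff_char hI, hs, hysum, add_zero]
    · exact h.2 I (((Finset.subset_insert_iff_of_notMem hm).1 hI).trans
        (Finset.subset_insert _ _)) hn hs

lemma blocks_step {S : Finset F} (h : GoodSet S) (hc : S.card < 6) (N : ℕ)
    (hN : ∀ y, y ∉ spanSet S → (blocksOver (insert y S)).card = N) :
    (blocksOver S).card * (7 - S.card) = (Fintype.card F - 2 ^ (S.card + 1)) * N := by
  have h1 : ∑ B ∈ blocksOver S, (B \ S).card = (blocksOver S).card * (7 - S.card) := by
    rw [Finset.sum_const_nat]
    intro B hB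
    rw [mem_blocksOver] at hB
    rw [Finset.card_sdiff_of_subset hB.2, hB.1.1]
  have h2 : ∑ B ∈ blocksOver S, (B \ S).card
      = ∑ y : F, ((blocksOver S).filter (fun B => y ∈ B \ S)).card := by
    have := Finset.sum_card_bipartiteAbove_eq_sum_card_bipartiteBelow
      (s := blocksOver S) (t := (Finset.univ : Finset F)) (fun B y => y ∈ B \ S)
    simp only [Finset.bipartiteAbove, Finset.bipartiteBelow] at this
    rw [← this]
    refine Finset.sum_congr rfl fun B _ => ?_
    congr 1
    ext a; simp
  have h3 : ∀ y : F, ((blocksOver S).filter (fun B => y ∈ B \ S)).card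
      = if y ∈ spanSet S then 0 else N := by
    intro y
    split_ifs with hy
    · rw [Finset.card_eq_zero, Finset.filter_eq_empty_iff]
      intro B hB hyB
      rw [mem_blocksOver] at hB
      rw [Finset.mem_sdiff] at hyB
      refine GoodSet.notMem_span hyB.2 (hB.1.good ?_ ?_) hy
      · exact Finset.insert_subset hyB.1 hB.2
      · intro he
        have := hB.1.1
        rw [← he, Finset.card_insert_of_notMem hyB.2] at this
        omega
    · rw [← hN y hy]
      congr 1
      ext B
      have hyS : y ∉ S := fun h' => hy (subset_spanSet (Finset.mem_insert_of_mem h'))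
      simp only [Finset.mem_filter, mem_blocksOver, Finset.mem_sdiff, Finset.insert_subset_iff]
      tauto
  rw [← h1, h2, Finset.sum_congr rfl (fun y _ => h3 y), Finset.sum_ite, Finset.sum_const_zero,
    zero_add, Finset.sum_const, smul_eq_mul]
  congr 1
  rw [← h.card_span, ← Finset.card_compl]
  congr 1
  ext a; simp

lemma blocks_count (d : ℕ) : ∀ S : Finset F, S.card + d = 6 → GoodSet S →
    (blocksOver S).card * (d + 1).factorial
      = ∏ i ∈ Finset.range d, (Fintype.card F - 2 ^ (6 - i)) := by
  induction d with
  | zero =>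
    intro S hS h
    simp [blocks_base h (by omega)]
  | succ d ih =>
    intro S hS h
    set P := ∏ i ∈ Finset.range d, (Fintype.card F - 2 ^ (6 - i)) with hP
    have hN : ∀ y, y ∉ spanSet S →
        (blocksOver (insert y S)).card = P / (d + 1).factorial := by
      intro y hy
      have hyS : y ∉ S := fun h' => hy (subset_spanSet (Finset.mem_insert_of_mem h'))
      rw [← ih (insert y S) (by rw [Finset.card_insert_of_notMem hyS]; omega) (h.insert_good hy),
        Nat.mul_div_cancel _ (Nat.factorial_pos _)]
    have hst := blocks_step h (by omega) _ hN
    have e1 : 7 - S.card = d + 2 := by omega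
    have e2 : S.card + 1 = 6 - d := by omega
    rw [e1, e2] at hst
    rw [Finset.prod_range_succ, ← hP, Nat.factorial_succ, ← mul_assoc, hst]
    by_cases hex : ∃ y, y ∉ spanSet S
    · obtain ⟨y, hy⟩ := hex
      have hyS : y ∉ S := fun h' => hy (subset_spanSet (Finset.mem_insert_of_mem h'))
      have := ih (insert y S) (by rw [Finset.card_insert_of_notMem hyS]; omega) (h.insert_good hy)
      rw [hN y hy] at this
      rw [mul_assoc, this, mul_comm]
    · have hu : spanSet S = Finset.univ := by
        ext a; simp only [Finset.mem_univ, iff_true]; by_contra h'; exact hex ⟨a, h'⟩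
      have := h.card_span
      rw [hu, Finset.card_univ, e2] at this
      simp [this]

end Helpers

lemma mem_designW_iff (m : ℕ) (B : Finset (GaloisField 2 m)) :
    B ∈ designW m 7 ↔ IsBlock B := by
  constructor
  · rintro ⟨hX, hc, hs, hI⟩
    refine ⟨hc, hs, fun I hIB hn h0 => ?_⟩
    refine hI (B \ I) Finset.sdiff_subset ?_ ?_ ?_
    · rw [Finset.sdiff_nonempty]
      intro h'
      rw [hIB.antisymm h', hs] at h0
      exact one_ne_zero h0
    · intro h'
      obtain ⟨a, ha⟩ := hn
      have := hIB ha
      rw [← h', Finset.mem_sdiff] at this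
      exact this.2 ha
    · rw [sum_sdiff_char hIB, h0, hs, add_zero]
  · intro h
    refine ⟨fun x hx => ⟨?_, ?_⟩, h.1, h.2.1, fun I hI _ hne => h.sum_ne_one hI hne⟩
    · rintro rfl
      exact h.2.2 {0} (by simpa using hx) (by simp) (by simp)
    · rintro rfl
      refine h.sum_ne_one (I := {1}) (by simpa using hx) ?_ (by simp)
      intro he
      have := h.1
      rw [← he] at this
      simp at this

/-- For `m ≥ 7`, every `x ∈ X` lies in exactly `r_7` blocks of `W_7`, and the total
number of blocks is `|W_7| = b_7`. -/
theorem repetition_and_block_numbers_W7 (m : ℕ) (hm : 7 ≤ m) :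
    (∀ x ∈ designX m, {B ∈ designW m 7 | x ∈ B}.ncard = (2 ^ m - 4) * (2 ^ m - 8) * (2 ^ m - 16) * (2 ^ m - 32) * (2 ^ m - 64) / Nat.factorial 6) ∧
    (designW m 7).ncard = (2 ^ m - 2) * (2 ^ m - 4) * (2 ^ m - 8) * (2 ^ m - 16) * (2 ^ m - 32) * (2 ^ m - 64) / Nat.factorial 7 := by
  haveI : Fintype (GaloisField 2 m) := Fintype.ofFinite _
  have hcard : Fintype.card (GaloisField 2 m) = 2 ^ m := by
    rw [← Nat.card_eq_fintype_card]
    exact GaloisField.card 2 m (by omega)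
  constructor
  · rintro x ⟨hx0, hx1⟩
    have hgood : GoodSet ({x} : Finset (GaloisField 2 m)) := by
      apply GoodSet.of
      · intro I hI hn
        rcases Finset.subset_singleton_iff.1 hI with rfl | rfl
        · simp at hn
        · simpa using hx0
      · intro I hI
        rcases Finset.subset_singleton_iff.1 hI with rfl | rfl
        · simp
        · simpa using hx1
    have hcount := blocks_count 5 {x} (by simp) hgood
    have hset : {B ∈ designW m 7 | x ∈ B} = (blocksOver {x} : Finset (Finset (GaloisField 2 m))) := by
      ext B
      simp [mem_blocksOver, mem_designW_iff]
    rw [hset, Set.ncard_coe_finset]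
    symm
    apply Nat.div_eq_of_eq_mul_left (Nat.factorial_pos _)
    rw [hcount, hcard]
    simp only [Finset.prod_range_succ, Finset.prod_range_zero]
    norm_num
    ring
  · have hgood : GoodSet (∅ : Finset (GaloisField 2 m)) := by
      apply GoodSet.of
      · intro I hI hn
        rw [Finset.subset_empty.1 hI] at hn
        simp at hn
      · intro I hI
        rw [Finset.subset_empty.1 hI]
        simp
    have hcount := blocks_count 6 ∅ (by simp) hgood
    have hset : designW m 7 = (blocksOver ∅ : Finset (Finset (GaloisField 2 m))) := by
      ext B
      simp [mem_blocksOver, mem_designW_iff]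
    rw [hset, Set.ncard_coe_finset]
    symm
    apply Nat.div_eq_of_eq_mul_left (Nat.factorial_pos _)
    rw [hcount, hcard]
    simp only [Finset.prod_range_succ, Finset.prod_range_zero]
    norm_num
    ring
end
end
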